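/- arXiv:2003.10194 — 2 statements merged into one kernel-verified Lean document; each statement's English description precedes it below -/
import Mathlib

section
/- On the Thurston geometry Sol³, the functions φ_1(t,x) = e^{−t}x_1 and φ_2(t,x) = e^{t}x_2 both satisfy τ(φ_i) = φ_i and κ(φ_i, φ_i) = φ_i² + 1; in particular they are isoparametric on Sol³. -/
open BigOperators

/-- Directional (partial) derivative of a complex-valued function along `v`. -/
noncomputable def pder {E : Type*} [NormedAddCommGroup E] [NormedSpace ℝ E]
    (v : E) (f : E → ℂ) (p : E) : ℂ :=
  fderiv ℝ f p v

/-- Unit coordinate vectors `(t, x₁, x₂)` on `Sol³ = ℝ ⋉ ℝ²`. -/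
def eT : ℝ × ℝ × ℝ := (1, 0, 0)
def eX1 : ℝ × ℝ × ℝ := (0, 1, 0)
def eX2 : ℝ × ℝ × ℝ := (0, 0, 1)

/-- The Laplace–Beltrami (tension) operator on `Sol³`:
`τ(φ) = ∂²φ/∂t² + e^{2t}∂²φ/∂x₁² + e^{−2t}∂²φ/∂x₂²`. -/
noncomputable def tensionSol (f : ℝ × ℝ × ℝ → ℂ) (p : ℝ × ℝ × ℝ) : ℂ :=
  pder eT (pder eT f) p
    + (Real.exp (2 * p.1) : ℂ) * pder eX1 (pder eX1 f) p
    + (Real.exp (-(2 * p.1)) : ℂ) * pder eX2 (pder eX2 f) p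

/-- The conformality operator on `Sol³`:
`κ(φ,ψ) = (∂φ/∂t)(∂ψ/∂t) + e^{2t}(∂φ/∂x₁)(∂ψ/∂x₁) + e^{−2t}(∂φ/∂x₂)(∂ψ/∂x₂)`. -/
noncomputable def confSol (f g : ℝ × ℝ × ℝ → ℂ) (p : ℝ × ℝ × ℝ) : ℂ :=
  pder eT f p * pder eT g p
    + (Real.exp (2 * p.1) : ℂ) * pder eX1 f p * pder eX1 g p
    + (Real.exp (-(2 * p.1)) : ℂ) * pder eX2 f p * pder eX2 g p

/-- The iterated Laplace–Beltrami operator on `Sol³`. -/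
noncomputable def tensionSolIter : ℕ → (ℝ × ℝ × ℝ → ℂ) → (ℝ × ℝ × ℝ → ℂ)
  | 0, f => f
  | r + 1, f => tensionSol (tensionSolIter r f)

/-- The function `(t, x) ↦ e^{ct} (ℓ(t, x) + k)`, with `ℓ` linear. -/
noncomputable def expAffine (c : ℝ) (l : ℝ × ℝ × ℝ →L[ℝ] ℝ) (k : ℝ) (p : ℝ × ℝ × ℝ) : ℂ :=
  ((Real.exp (c * p.1) * (l p + k) : ℝ) : ℂ)

theorem pder_expAffine (v : ℝ × ℝ × ℝ) (c : ℝ) (l : ℝ × ℝ × ℝ →L[ℝ] ℝ) (k : ℝ) :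
    pder v (expAffine c l k) = expAffine c ((c * v.1) • l) (c * v.1 * k + l v) := by
  funext p
  have h₁ : HasFDerivAt (fun q : ℝ × ℝ × ℝ => Real.exp (c * q.1))
      (Real.exp (c * p.1) • c • ContinuousLinearMap.fst ℝ ℝ (ℝ × ℝ)) p :=
    (hasFDerivAt_fst.const_mul c).exp
  have h := Complex.ofRealCLM.hasFDerivAt.comp p (h₁.mul (l.hasFDerivAt.add_const k))
  have h' : HasFDerivAt (expAffine c l k) _ p := h
  rw [pder, h'.fderiv]
  simp [expAffine]
  ring

/-- Example 5.10. On `Sol³` the functions `φ₁(t,x) = e^{−t}x₁` and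
`φ₂(t,x) = e^{t}x₂` satisfy `τ(φᵢ) = φᵢ` and `κ(φᵢ,φᵢ) = φᵢ² + 1`; in particular they are
isoparametric on `Sol³`. -/
theorem isoparametric_Sol3
    (φ₁ φ₂ : ℝ × ℝ × ℝ → ℂ)
    (hφ₁ : ∀ (t x₁ x₂ : ℝ), φ₁ (t, x₁, x₂) = (Real.exp (-t) : ℂ) * (x₁ : ℂ))
    (hφ₂ : ∀ (t x₁ x₂ : ℝ), φ₂ (t, x₁, x₂) = (Real.exp t : ℂ) * (x₂ : ℂ)) :
    (∀ p, tensionSol φ₁ p = φ₁ p) ∧ (∀ p, confSol φ₁ φ₁ p = (φ₁ p) ^ 2 + 1) ∧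
      (∀ p, tensionSol φ₂ p = φ₂ p) ∧ (∀ p, confSol φ₂ φ₂ p = (φ₂ p) ^ 2 + 1) := by
  let l₁ : ℝ × ℝ × ℝ →L[ℝ] ℝ :=
    (ContinuousLinearMap.fst ℝ ℝ ℝ).comp (ContinuousLinearMap.snd ℝ ℝ (ℝ × ℝ))
  let l₂ : ℝ × ℝ × ℝ →L[ℝ] ℝ :=
    (ContinuousLinearMap.snd ℝ ℝ ℝ).comp (ContinuousLinearMap.snd ℝ ℝ (ℝ × ℝ))
  have h₁ : φ₁ = expAffine (-1) l₁ 0 := by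
    funext ⟨t, x₁, x₂⟩
    simp [hφ₁, expAffine, l₁]
  have h₂ : φ₂ = expAffine 1 l₂ 0 := by
    funext ⟨t, x₁, x₂⟩
    simp [hφ₂, expAffine, l₂]
  have hexp (t : ℝ) : Complex.exp (2 * t) = Complex.exp t ^ 2 := by
    rw [← Complex.exp_nat_mul]
    norm_num
  subst h₁ h₂
  refine ⟨fun p => ?_, fun p => ?_, fun p => ?_, fun p => ?_⟩
  · simp [tensionSol, pder_expAffine, expAffine, l₁, eT, eX1, eX2]
  · simp [confSol, pder_expAffine, expAffine, l₁, eT, eX1, eX2, Complex.exp_neg, hexp]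
    field_simp
  · simp [tensionSol, pder_expAffine, expAffine, l₂, eT, eX1, eX2]
  · simp [confSol, pder_expAffine, expAffine, l₂, eT, eX1, eX2, Complex.exp_neg, hexp]
    field_simp
end

section
/- For every integer r ≥ 1 and every nonzero pair (c_1,c_2) ∈ ℂ², the functions (t,x) ↦ c_1·arsinh(e^{−t}x_1)^{2r−1} + c_2·arsinh(e^{−t}x_1)^{2r−2} and (t,x) ↦ c_1·arsinh(e^{t}x_2)^{2r−1} + c_2·arsinh(e^{t}x_2)^{2r−2} each satisfy τ^r ≡ 0 and τ^{r−1} ≢ 0, i.e. they are proper r-harmonic on Sol³. Here arsinh denotes the real inverse hyperbolic sine. -/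
open BigOperators

open Polynomial in
/-- The derivative of `s ↦ P(s)` for a complex polynomial `P` and a real variable `s`. -/
theorem hasDerivAt_eval_ofReal (P : ℂ[X]) (s : ℝ) :
    HasDerivAt (fun s : ℝ => P.eval (s : ℂ)) (P.derivative.eval (s : ℂ)) s :=
  (P.hasDerivAt (s : ℂ)).comp_ofReal

section ScaledCoordinate

variable (ε : ℝ) (ℓ : ℝ × ℝ × ℝ →L[ℝ] ℝ)

/-- The function `(t, x) ↦ e^{εt} ℓ(t, x)` for a linear functional `ℓ`. -/
noncomputable def scaledCoord (p : ℝ × ℝ × ℝ) : ℝ := Real.exp (ε * p.1) * ℓ p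

theorem hasFDerivAt_exp_mul_fst (p : ℝ × ℝ × ℝ) :
    HasFDerivAt (fun q : ℝ × ℝ × ℝ => Real.exp (ε * q.1))
      (Real.exp (ε * p.1) • ε • ContinuousLinearMap.fst ℝ ℝ (ℝ × ℝ)) p :=
  ((hasFDerivAt_fst (𝕜 := ℝ) (p := p)).const_mul ε).exp

theorem hasFDerivAt_scaledCoord (p : ℝ × ℝ × ℝ) :
    HasFDerivAt (scaledCoord ε ℓ)
      (Real.exp (ε * p.1) • ℓ
        + ℓ p • (Real.exp (ε * p.1) • ε • ContinuousLinearMap.fst ℝ ℝ (ℝ × ℝ))) p :=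
  (hasFDerivAt_exp_mul_fst ε p).mul ℓ.hasFDerivAt

variable {F F' : ℝ → ℂ}

theorem pder_comp_scaledCoord (hF : ∀ u, HasDerivAt F (F' u) u) (v p : ℝ × ℝ × ℝ) :
    pder v (fun q => F (scaledCoord ε ℓ q)) p
      = ((Real.exp (ε * p.1) * (ℓ v + ε * v.1 * ℓ p) : ℝ) : ℂ) * F' (scaledCoord ε ℓ p) := by
  have h := (hF (scaledCoord ε ℓ p)).hasFDerivAt.comp p (hasFDerivAt_scaledCoord ε ℓ p)
  have h' := congrArg (fun L => L v) h.fderiv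
  simp only [Function.comp_def] at h'
  rw [pder, h']
  simp
  ring

theorem pder_eT_comp_scaledCoord (hℓ : ℓ eT = 0) (hF : ∀ u, HasDerivAt F (F' u) u) :
    pder eT (fun q => F (scaledCoord ε ℓ q))
      = fun q => (fun u : ℝ => ((ε * u : ℝ) : ℂ) * F' u) (scaledCoord ε ℓ q) := by
  funext p
  rw [pder_comp_scaledCoord ε ℓ hF, hℓ]
  simp only [eT, scaledCoord]
  push_cast
  ring

theorem pder_eT_pder_eT_comp_scaledCoord {F'' : ℝ → ℂ} (hℓ : ℓ eT = 0)
    (hF : ∀ u, HasDerivAt F (F' u) u) (hF' : ∀ u, HasDerivAt F' (F'' u) u) (p : ℝ × ℝ × ℝ) :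
    pder eT (pder eT (fun q => F (scaledCoord ε ℓ q))) p
      = (ε : ℂ) ^ 2 * (scaledCoord ε ℓ p * F' (scaledCoord ε ℓ p)
          + (scaledCoord ε ℓ p : ℂ) ^ 2 * F'' (scaledCoord ε ℓ p)) := by
  have h (u : ℝ) : HasDerivAt (fun u : ℝ => ((ε * u : ℝ) : ℂ) * F' u)
      ((ε : ℂ) * F' u + ((ε * u : ℝ) : ℂ) * F'' u) u := by
    have h₁ : HasDerivAt (fun u : ℝ => ((ε * u : ℝ) : ℂ)) (ε : ℂ) u := by
      simpa using ((hasDerivAt_id u).const_mul ε).ofReal_comp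
    exact h₁.mul (hF' u)
  rw [pder_eT_comp_scaledCoord ε ℓ hℓ hF, pder_eT_comp_scaledCoord ε ℓ hℓ h]
  push_cast
  ring

theorem pder_pder_comp_scaledCoord {F'' : ℝ → ℂ} {v : ℝ × ℝ × ℝ} (hv : v.1 = 0)
    (hF : ∀ u, HasDerivAt F (F' u) u) (hF' : ∀ u, HasDerivAt F' (F'' u) u) (p : ℝ × ℝ × ℝ) :
    pder v (pder v (fun q => F (scaledCoord ε ℓ q))) p
      = (Real.exp (2 * (ε * p.1)) : ℂ) * (ℓ v : ℂ) ^ 2 * F'' (scaledCoord ε ℓ p) := by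
  have h₁ : pder v (fun q => F (scaledCoord ε ℓ q))
      = fun q => ((Real.exp (ε * q.1) * ℓ v : ℝ) : ℂ) * F' (scaledCoord ε ℓ q) := by
    funext q
    rw [pder_comp_scaledCoord ε ℓ hF, hv]
    simp
  have h₂ := Complex.ofRealCLM.hasFDerivAt.comp p
    ((hasFDerivAt_exp_mul_fst ε p).mul_const (ℓ v))
  have h₃ := (hF' (scaledCoord ε ℓ p)).hasFDerivAt.comp p (hasFDerivAt_scaledCoord ε ℓ p)
  have h₄ := congrArg (fun L => L v) (h₂.mul h₃).fderiv
  have h₅ : (fun q : ℝ × ℝ × ℝ => ((Real.exp (ε * q.1) * ℓ v : ℝ) : ℂ) * F' (scaledCoord ε ℓ q))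
      = (Complex.ofRealCLM ∘ fun q : ℝ × ℝ × ℝ => Real.exp (ε * q.1) * ℓ v)
        * (F' ∘ scaledCoord ε ℓ) := rfl
  rw [h₁, h₅, pder, h₄, two_mul, Real.exp_add]
  simp [hv]
  ring

end ScaledCoordinate

theorem hasDerivAt_inv_sqrt_one_add_sq (u : ℝ) :
    HasDerivAt (fun u : ℝ => (√(1 + u ^ 2))⁻¹) (-u * (√(1 + u ^ 2))⁻¹ ^ 3) u := by
  have hpos : 0 < 1 + u ^ 2 := by positivity
  have h := ((((hasDerivAt_id u).pow 2).const_add 1).sqrt hpos.ne').inv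
    (Real.sqrt_pos.2 hpos).ne'
  refine h.congr_deriv ?_
  have := (Real.sqrt_pos.2 hpos).ne'
  simp
  field_simp

/-- On `P ∘ arsinh ∘ scaledCoord ε ℓ`, the tension operator acts as `P ↦ P''`. -/
theorem tensionSol_eval_arsinh (P : Polynomial ℂ) (ε : ℝ) (ℓ : ℝ × ℝ × ℝ →L[ℝ] ℝ)
    (hε : ε ^ 2 = 1) (hℓ : ℓ eT = 0)
    (hw : ∀ t : ℝ, Real.exp (2 * t) * (Real.exp (2 * (ε * t)) * ℓ eX1 ^ 2)
      + Real.exp (-(2 * t)) * (Real.exp (2 * (ε * t)) * ℓ eX2 ^ 2) = 1) :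
    tensionSol (fun p => P.eval (Real.arsinh (scaledCoord ε ℓ p) : ℂ))
      = fun p => P.derivative.derivative.eval (Real.arsinh (scaledCoord ε ℓ p) : ℂ) := by
  have key (Q : Polynomial ℂ) (u : ℝ) : HasDerivAt (fun u => Q.eval (Real.arsinh u : ℂ))
      (((√(1 + u ^ 2))⁻¹ : ℝ) * Q.derivative.eval (Real.arsinh u : ℂ)) u := by
    have h := (hasDerivAt_eval_ofReal Q (Real.arsinh u)).scomp u (Real.hasDerivAt_arsinh u)
    simpa only [Function.comp_def, Complex.real_smul] using h
  have key' (u : ℝ) := (hasDerivAt_inv_sqrt_one_add_sq u).ofReal_comp.mul (key P.derivative u)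
  funext p
  simp only [tensionSol]
  rw [pder_eT_pder_eT_comp_scaledCoord ε ℓ hℓ (key P) key',
    pder_pder_comp_scaledCoord ε ℓ (v := eX1) rfl (key P) key',
    pder_pder_comp_scaledCoord ε ℓ (v := eX2) rfl (key P) key']
  generalize scaledCoord ε ℓ p = u
  have hs : ((√(1 + u ^ 2))⁻¹ : ℝ) ^ 2 * (1 + u ^ 2) = 1 := by
    rw [inv_pow, Real.sq_sqrt (by positivity), inv_mul_cancel₀ (by positivity)]
  have hw' := hw p.1
  generalize (√(1 + u ^ 2))⁻¹ = w at *
  have hsC : (w : ℂ) ^ 2 * (1 + (u : ℂ) ^ 2) = 1 := by exact_mod_cast hs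
  have hεC : (ε : ℂ) ^ 2 = 1 := by exact_mod_cast hε
  have hwC : (Real.exp (2 * p.1) : ℂ) * ((Real.exp (2 * (ε * p.1)) : ℂ) * (ℓ eX1 : ℂ) ^ 2)
      + (Real.exp (-(2 * p.1)) : ℂ) * ((Real.exp (2 * (ε * p.1)) : ℂ) * (ℓ eX2 : ℂ) ^ 2) = 1 := by
    exact_mod_cast hw'
  rw [hεC]
  generalize P.derivative.derivative.eval (Real.arsinh u : ℂ) = B
  generalize P.derivative.eval (Real.arsinh u : ℂ) = A
  push_cast at *
  linear_combination (-u * w ^ 3 * A + w ^ 2 * B) * hwC + (B - u * w * A) * hsC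

theorem tensionSolIter_eval_arsinh (P : Polynomial ℂ) (ε : ℝ) (ℓ : ℝ × ℝ × ℝ →L[ℝ] ℝ)
    (hε : ε ^ 2 = 1) (hℓ : ℓ eT = 0)
    (hw : ∀ t : ℝ, Real.exp (2 * t) * (Real.exp (2 * (ε * t)) * ℓ eX1 ^ 2)
      + Real.exp (-(2 * t)) * (Real.exp (2 * (ε * t)) * ℓ eX2 ^ 2) = 1) (n : ℕ) :
    tensionSolIter n (fun p => P.eval (Real.arsinh (scaledCoord ε ℓ p) : ℂ))
      = fun p => (Polynomial.derivative^[2 * n] P).eval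
          (Real.arsinh (scaledCoord ε ℓ p) : ℂ) := by
  induction n with
  | zero => rfl
  | succ n ih =>
    rw [tensionSolIter, ih, tensionSol_eval_arsinh _ ε ℓ hε hℓ hw, Nat.mul_succ,
      Function.iterate_add_apply, ← Function.iterate_add_apply, Nat.add_comm,
      Function.iterate_add_apply]
    rfl

open Polynomial in
theorem iterate_derivative_linear_mul_X_pow (c₁ c₂ : ℂ) (k : ℕ) :
    derivative^[k] (C c₁ * X ^ (k + 1) + C c₂ * X ^ k)
      = C ((k + 1).factorial * c₁) * X + C (k.factorial * c₂) := by
  rw [iterate_map_add, iterate_derivative_C_mul, iterate_derivative_C_mul,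
    iterate_derivative_X_pow_eq_natCast_mul, iterate_derivative_X_pow_eq_natCast_mul]
  have h := Nat.factorial_mul_descFactorial (Nat.le_succ k)
  rw [Nat.succ_sub (le_refl k), Nat.sub_self, Nat.factorial_one, one_mul] at h
  simp [h, Nat.descFactorial_self]
  ring

open Polynomial in
theorem tensionSolIter_proper (m : ℕ) {c₁ c₂ : ℂ} (hc : ¬ (c₁ = 0 ∧ c₂ = 0))
    (ε : ℝ) (ℓ : ℝ × ℝ × ℝ →L[ℝ] ℝ) (hε : ε ^ 2 = 1) (hℓ : ℓ eT = 0)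
    (hw : ∀ t : ℝ, Real.exp (2 * t) * (Real.exp (2 * (ε * t)) * ℓ eX1 ^ 2)
      + Real.exp (-(2 * t)) * (Real.exp (2 * (ε * t)) * ℓ eX2 ^ 2) = 1)
    (hsurj : Function.Surjective (scaledCoord ε ℓ)) {φ : ℝ × ℝ × ℝ → ℂ}
    (hφ : ∀ p, φ p = c₁ * (Real.arsinh (scaledCoord ε ℓ p) : ℂ) ^ (2 * m + 1)
      + c₂ * (Real.arsinh (scaledCoord ε ℓ p) : ℂ) ^ (2 * m)) :
    (∀ p, tensionSolIter (m + 1) φ p = 0) ∧ ∃ p, tensionSolIter m φ p ≠ 0 := by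
  have hP : φ = fun p => (C c₁ * X ^ (2 * m + 1) + C c₂ * X ^ (2 * m)).eval
      (Real.arsinh (scaledCoord ε ℓ p) : ℂ) := by
    funext p
    simp [hφ]
  rw [hP]
  simp only [tensionSolIter_eval_arsinh _ ε ℓ hε hℓ hw]
  constructor
  · intro p
    rw [Nat.mul_succ, Nat.add_comm, Function.iterate_add_apply,
      iterate_derivative_linear_mul_X_pow]
    simp
  · by_contra! h
    rw [iterate_derivative_linear_mul_X_pow] at h
    obtain ⟨p, hp⟩ := hsurj (Real.sinh 0)
    obtain ⟨q, hq⟩ := hsurj (Real.sinh 1)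
    have h₀ := h p
    have h₁ := h q
    rw [hp, Real.arsinh_sinh] at h₀
    rw [hq, Real.arsinh_sinh] at h₁
    have h₂ : c₂ = 0 := by simpa [Nat.factorial_ne_zero] using h₀
    have h₃ : c₁ = 0 := by
      simpa [h₂, Nat.factorial_ne_zero] using h₁
    exact hc ⟨h₃, h₂⟩

/-- Example 5.10. For `r ≥ 1` and `(c₁,c₂) ≠ 0`, the functions
`(t,x) ↦ c₁ arsinh(e^{−t}x₁)^{2r−1} + c₂ arsinh(e^{−t}x₁)^{2r−2}` and
`(t,x) ↦ c₁ arsinh(e^{t}x₂)^{2r−1} + c₂ arsinh(e^{t}x₂)^{2r−2}` are proper `r`-harmonic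
on `Sol³`. -/
theorem proper_r_harmonic_Sol3
    (r : ℕ) (hr : 1 ≤ r) (c₁ c₂ : ℂ) (hc : ¬ (c₁ = 0 ∧ c₂ = 0))
    (φ₁ φ₂ : ℝ × ℝ × ℝ → ℂ)
    (hφ₁ : ∀ (t x₁ x₂ : ℝ), φ₁ (t, x₁, x₂)
      = c₁ * (Real.arsinh (Real.exp (-t) * x₁) : ℂ) ^ (2 * r - 1)
        + c₂ * (Real.arsinh (Real.exp (-t) * x₁) : ℂ) ^ (2 * r - 2))
    (hφ₂ : ∀ (t x₁ x₂ : ℝ), φ₂ (t, x₁, x₂)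
      = c₁ * (Real.arsinh (Real.exp t * x₂) : ℂ) ^ (2 * r - 1)
        + c₂ * (Real.arsinh (Real.exp t * x₂) : ℂ) ^ (2 * r - 2)) :
    ((∀ p, tensionSolIter r φ₁ p = 0) ∧ (∃ p, tensionSolIter (r - 1) φ₁ p ≠ 0)) ∧
      ((∀ p, tensionSolIter r φ₂ p = 0) ∧ (∃ p, tensionSolIter (r - 1) φ₂ p ≠ 0)) := by
  obtain ⟨m, rfl⟩ : ∃ m, r = m + 1 := ⟨r - 1, by omega⟩
  have h₁ : 2 * (m + 1) - 1 = 2 * m + 1 := by omega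
  have h₂ : 2 * (m + 1) - 2 = 2 * m := by omega
  rw [h₁, h₂] at hφ₁ hφ₂
  rw [Nat.add_sub_cancel]
  let π₁ : ℝ × ℝ × ℝ →L[ℝ] ℝ :=
    (ContinuousLinearMap.fst ℝ ℝ ℝ).comp (ContinuousLinearMap.snd ℝ ℝ (ℝ × ℝ))
  let π₂ : ℝ × ℝ × ℝ →L[ℝ] ℝ :=
    (ContinuousLinearMap.snd ℝ ℝ ℝ).comp (ContinuousLinearMap.snd ℝ ℝ (ℝ × ℝ))
  constructor
  · refine tensionSolIter_proper m hc (-1) π₁ (by norm_num) rfl (fun t => ?_)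
      (fun y => ⟨(0, y, 0), by simp [scaledCoord, π₁]⟩) (fun ⟨t, x₁, x₂⟩ => ?_)
    · simp [π₁, eX1, eX2, ← Real.exp_add]
    · simp [hφ₁, scaledCoord, π₁]
  · refine tensionSolIter_proper m hc 1 π₂ (by norm_num) rfl (fun t => ?_)
      (fun y => ⟨(0, 0, y), by simp [scaledCoord, π₂]⟩) (fun ⟨t, x₁, x₂⟩ => ?_)
    · simp [π₂, eX1, eX2, ← Real.exp_add]
    · simp [hφ₂, scaledCoord, π₂]
end
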